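/- arXiv:2311.04318 — 4 statements merged into one kernel-verified Lean document; each statement's English description precedes it below -/
import Mathlib

section
/- Let μ : ℝ → ℝ be continuous and nonnegative, let η > 0, and let T* be a nonnegative random variable with probability density f(t) = μ(t) exp(−∫_0^t μ(u) du) for t ≥ 0, independent of a nonnegative random variable U with cumulative distribution function F. Define the observed sub-distribution function G(t) = ℙ(T* ≤ t and T* + U ≤ η). Then at every t ∈ (0, η) at which F is continuous at η − t, G is differentiable with derivative G'(t) = μ(t) exp(−∫_0^t μ(u) du) F(η − t). -/
open MeasureTheory ProbabilityTheory

/-- Density of the observed (thinned) jump time: if `T` has hazard rate `μ` (so density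
`f t = μ t * exp (-∫_0^t μ)` for `t ≥ 0`) and is independent of the delay `U` with cdf
`F`, then the sub-distribution function `G t = ℙ(T ≤ t, T + U ≤ η)` is differentiable at
each `t ∈ (0, η)` where `F` is continuous at `η - t`, with derivative
`μ t * exp (-∫_0^t μ) * F (η - t)`. -/
theorem observed_density {Ω : Type*} [MeasurableSpace Ω]
    (Pr : Measure Ω) [IsProbabilityMeasure Pr]
    (μ : ℝ → ℝ) (hμc : Continuous μ) (hμnn : ∀ t, 0 ≤ μ t)
    (η : ℝ) (hη : 0 < η)
    (T U : Ω → ℝ) (hT : Measurable T) (hU : Measurable U)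
    (hTnn : ∀ ω, 0 ≤ T ω) (hUnn : ∀ ω, 0 ≤ U ω)
    (hind : IndepFun T U Pr)
    (f : ℝ → ℝ)
    (hf : ∀ t, f t = if 0 ≤ t then μ t * Real.exp (-∫ u in (0:ℝ)..t, μ u) else 0)
    (hpdf : Pr.map T = volume.withDensity fun t => ENNReal.ofReal (f t))
    (F : ℝ → ℝ) (hF : ∀ t, F t = (Pr {ω | U ω ≤ t}).toReal)
    (G : ℝ → ℝ) (hG : ∀ t, G t = (Pr {ω | T ω ≤ t ∧ T ω + U ω ≤ η}).toReal)
    (t : ℝ) (ht : t ∈ Set.Ioo 0 η) (hFc : ContinuousAt F (η - t)) :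
    HasDerivAt G (μ t * Real.exp (-∫ u in (0:ℝ)..t, μ u) * F (η - t)) t := by
  have hprim : Continuous fun s : ℝ => μ s * Real.exp (-∫ u in (0:ℝ)..s, μ u) := by
    have h1 : Continuous fun s : ℝ => ∫ u in (0:ℝ)..s, μ u :=
      intervalIntegral.continuous_primitive (fun a b => hμc.intervalIntegrable a b) 0
    exact hμc.mul (Real.continuous_exp.comp h1.neg)
  have hfeq : f = fun s => if 0 ≤ s then μ s * Real.exp (-∫ u in (0:ℝ)..s, μ u) else 0 :=
    funext hf
  have hfm : Measurable f := by
    rw [hfeq]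
    exact Measurable.ite measurableSet_Ici hprim.measurable measurable_const
  have hfnn : ∀ s, 0 ≤ f s := by
    intro s
    rw [hf]
    split_ifs
    · exact mul_nonneg (hμnn s) (Real.exp_pos _).le
    · exact le_rfl
  have hFmono : Monotone F := by
    intro a b hab
    rw [hF, hF]
    apply ENNReal.toReal_mono (measure_ne_top _ _)
    exact measure_mono fun ω (hω : U ω ≤ a) => hω.trans hab
  have hFnn : ∀ s, 0 ≤ F s := fun s => by rw [hF]; exact ENNReal.toReal_nonneg
  have hFle : ∀ s, F s ≤ 1 := fun s => by
    rw [hF]; exact ENNReal.toReal_le_of_le_ofReal zero_le_one (by simpa using prob_le_one)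
  have hFm : Measurable fun x => F (η - x) :=
    hFmono.measurable.comp (measurable_const.sub measurable_id)
  have hprob : IsProbabilityMeasure (Pr.map T) := Measure.isProbabilityMeasure_map hT.aemeasurable
  have hprobU : IsProbabilityMeasure (Pr.map U) := Measure.isProbabilityMeasure_map hU.aemeasurable
  have hfint : Integrable f := by
    refine ⟨hfm.aestronglyMeasurable, ?_⟩
    rw [hasFiniteIntegral_iff_ofReal (Filter.Eventually.of_forall hfnn)]
    have h1 : (Pr.map T) Set.univ = 1 := measure_univ
    rw [hpdf, withDensity_apply _ MeasurableSet.univ, Measure.restrict_univ] at h1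
    rw [h1]; exact ENNReal.one_lt_top
  have hhm : Measurable fun x => f x * F (η - x) := hfm.mul hFm
  have hhnn : ∀ x, 0 ≤ f x * F (η - x) := fun x => mul_nonneg (hfnn x) (hFnn _)
  have hhint : Integrable fun x => f x * F (η - x) := by
    refine hfint.mono hhm.aestronglyMeasurable (Filter.Eventually.of_forall fun x => ?_)
    rw [Real.norm_of_nonneg (hhnn x), Real.norm_of_nonneg (hfnn x)]
    exact mul_le_of_le_one_right (hfnn x) (hFle _)
  have hGint : ∀ s, G s = ∫ x in Set.Iic s, f x * F (η - x) := by
    intro s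
    rw [hG, integral_eq_lintegral_of_nonneg_ae (Filter.Eventually.of_forall hhnn)
      hhm.aestronglyMeasurable]
    congr 1
    have hS : MeasurableSet {p : ℝ × ℝ | p.1 ≤ s ∧ p.1 + p.2 ≤ η} :=
      (measurableSet_le measurable_fst measurable_const).inter
        (measurableSet_le (measurable_fst.add measurable_snd) measurable_const)
    have h1 : Pr {ω | T ω ≤ s ∧ T ω + U ω ≤ η}
        = (Pr.map fun ω => (T ω, U ω)) {p : ℝ × ℝ | p.1 ≤ s ∧ p.1 + p.2 ≤ η} := by
      rw [Measure.map_apply (hT.prodMk hU) hS]; rfl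
    have h2 : ∀ x, (Pr.map U) (Prod.mk x ⁻¹' {p : ℝ × ℝ | p.1 ≤ s ∧ p.1 + p.2 ≤ η})
        = (Set.Iic s).indicator (fun x => ENNReal.ofReal (F (η - x))) x := by
      intro x
      by_cases hx : x ≤ s
      · rw [Set.indicator_of_mem (show x ∈ Set.Iic s from hx), hF,
          ENNReal.ofReal_toReal (measure_ne_top _ _),
          Measure.map_apply hU (measurable_prodMk_left hS)]
        congr 1
        ext ω
        simp only [Set.mem_preimage, Set.mem_setOf_eq, hx, true_and]
        constructor <;> intro h <;> linarith
      · rw [Set.indicator_of_notMem (show x ∉ Set.Iic s from hx)]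
        simp [hx]
    rw [h1, (indepFun_iff_map_prod_eq_prod_map_map hT.aemeasurable hU.aemeasurable).1 hind,
      Measure.prod_apply hS]
    simp_rw [h2]
    rw [lintegral_indicator measurableSet_Iic, hpdf,
      restrict_withDensity measurableSet_Iic,
      lintegral_withDensity_eq_lintegral_mul _ hfm.ennreal_ofReal hFm.ennreal_ofReal]
    refine lintegral_congr fun x => ?_
    rw [Pi.mul_apply, ENNReal.ofReal_mul (hfnn x)]
  have hGeq : G = fun s => (∫ x in Set.Iic (0:ℝ), f x * F (η - x))
      + ∫ x in (0:ℝ)..s, f x * F (η - x) := by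
    funext s
    rw [hGint, ← intervalIntegral.integral_Iic_sub_Iic hhint.integrableOn hhint.integrableOn]
    ring
  have hev : (fun x => μ x * Real.exp (-∫ u in (0:ℝ)..x, μ u)) =ᶠ[nhds t] f := by
    filter_upwards [lt_mem_nhds ht.1] with x hx
    rw [hf, if_pos hx.le]
  have hfc : ContinuousAt f t := hprim.continuousAt.congr hev
  have hFc' : ContinuousAt (fun x => F (η - x)) t :=
    ContinuousAt.comp (f := fun x => η - x) hFc (by fun_prop)
  have hd := (intervalIntegral.integral_hasDerivAt_right (a := 0) (b := t)
    hhint.intervalIntegrable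
    (hhm.stronglyMeasurable.stronglyMeasurableAtFilter) (hfc.mul hFc')).const_add
    (∫ x in Set.Iic (0:ℝ), f x * F (η - x))
  rw [hGeq]
  rw [hf t, if_pos ht.1.le] at hd
  exact hd
end

section
/- Let μ : ℝ → ℝ be continuous and nonnegative, let η > 0, and let T* be a nonnegative random variable with probability density f(t) = μ(t) S(t), where S(t) = exp(−∫_0^t μ(u) du), independent of a nonnegative random variable U with continuous cumulative distribution function F. Define the weighted hazard ν(t) = μ(t) F(η − t) and the observed sub-distribution function G(t) = ℙ(T* ≤ t and T* + U ≤ η). Then for every t ∈ (0, η), 1 − G(t) ≥ S(t) > 0 and the hazard rate of the observed jump time satisfies G'(t) / (1 − G(t)) = γ(t) ν(t), where γ(t) = (1 − ∫_0^t S(s) μ(s) ds) / (1 − ∫_0^t S(s) ν(s) ds). -/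
open MeasureTheory ProbabilityTheory

/-- Single-sojourn special case of the hazard link (Lemma 1): the hazard rate of the
observed jump time `G' (t) / (1 - G t)` equals the weighted hazard
`ν t = μ t * F (η - t)` times the correction factor
`γ t = (1 - ∫_0^t S μ) / (1 - ∫_0^t S ν)`. -/
theorem hazard_link_single {Ω : Type*} [MeasurableSpace Ω]
    (Pr : Measure Ω) [IsProbabilityMeasure Pr]
    (μ : ℝ → ℝ) (hμc : Continuous μ) (hμnn : ∀ t, 0 ≤ μ t)
    (η : ℝ) (hη : 0 < η)
    (T U : Ω → ℝ) (hT : Measurable T) (hU : Measurable U)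
    (hTnn : ∀ ω, 0 ≤ T ω) (hUnn : ∀ ω, 0 ≤ U ω)
    (hind : IndepFun T U Pr)
    (S : ℝ → ℝ) (hS : ∀ t, S t = Real.exp (-∫ u in (0:ℝ)..t, μ u))
    (f : ℝ → ℝ) (hf : ∀ t, f t = if 0 ≤ t then μ t * S t else 0)
    (hpdf : Pr.map T = volume.withDensity fun t => ENNReal.ofReal (f t))
    (F : ℝ → ℝ) (hF : ∀ t, F t = (Pr {ω | U ω ≤ t}).toReal)
    (hFc : Continuous F)
    (ν : ℝ → ℝ) (hν : ∀ t, ν t = μ t * F (η - t))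
    (G : ℝ → ℝ) (hG : ∀ t, G t = (Pr {ω | T ω ≤ t ∧ T ω + U ω ≤ η}).toReal)
    (t : ℝ) (ht : t ∈ Set.Ioo 0 η) :
    (S t ≤ 1 - G t ∧ 0 < S t) ∧
      deriv G t / (1 - G t)
        = ((1 - ∫ s in (0:ℝ)..t, S s * μ s) / (1 - ∫ s in (0:ℝ)..t, S s * ν s)) * ν t := by
  have hSd : ∀ x, HasDerivAt S (-(S x * μ x)) x := by
    intro x
    have h1 : HasDerivAt (fun t => ∫ u in (0:ℝ)..t, μ u) (μ x) x :=
      intervalIntegral.integral_hasDerivAt_right (hμc.intervalIntegrable _ _)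
        hμc.stronglyMeasurable.stronglyMeasurableAtFilter hμc.continuousAt
    have h2 := h1.neg.exp
    have e : S = fun t => Real.exp (-∫ u in (0:ℝ)..t, μ u) := funext hS
    rw [e]
    refine h2.congr_deriv ?_
    simp only [Pi.neg_apply]
    ring
  have hSc : Continuous S := continuous_iff_continuousAt.2 fun x => (hSd x).continuousAt
  have hSpos : ∀ x, 0 < S x := fun x => by rw [hS]; exact Real.exp_pos _
  have hFnn : ∀ x, 0 ≤ F x := fun x => by rw [hF]; exact ENNReal.toReal_nonneg
  have hF1 : ∀ x, F x ≤ 1 := fun x => by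
    rw [hF]; exact ENNReal.toReal_le_of_le_ofReal zero_le_one (by simpa using prob_le_one)
  have hνc : Continuous ν := by
    have e : ν = fun t => μ t * F (η - t) := funext hν
    rw [e]; fun_prop
  have hνnn : ∀ x, 0 ≤ ν x := fun x => by rw [hν]; exact mul_nonneg (hμnn x) (hFnn _)
  have hνμ : ∀ x, ν x ≤ μ x := fun x => by
    rw [hν]; exact mul_le_of_le_one_right (hμnn x) (hF1 _)
  have hSμ : ∫ s in (0:ℝ)..t, S s * μ s = 1 - S t := by
    have h := intervalIntegral.integral_eq_sub_of_hasDerivAt (a := (0:ℝ)) (b := t)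
      (fun x _ => hSd x) ((hSc.mul hμc).neg.intervalIntegrable _ _)
    rw [intervalIntegral.integral_neg] at h
    have h0 : S 0 = 1 := by rw [hS]; simp
    rw [h0] at h
    linarith
  have hGint : ∀ x, 0 ≤ x → G x = ∫ s in (0:ℝ)..x, S s * ν s := by
    intro x hx
    have hA : MeasurableSet {p : ℝ × ℝ | p.1 ≤ x ∧ p.1 + p.2 ≤ η} :=
      (measurableSet_le measurable_fst measurable_const).inter
        (measurableSet_le (measurable_fst.add measurable_snd) measurable_const)
    have hfm : Measurable f := by
      have e : f = fun t => if 0 ≤ t then μ t * S t else 0 := funext hf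
      rw [e]
      exact Measurable.ite measurableSet_Ici (hμc.mul hSc).measurable measurable_const
    have hprod := (indepFun_iff_map_prod_eq_prod_map_map hT.aemeasurable hU.aemeasurable).1 hind
    have hPU : IsProbabilityMeasure (Pr.map U) := Measure.isProbabilityMeasure_map hU.aemeasurable
    have h1 : Pr {ω | T ω ≤ x ∧ T ω + U ω ≤ η}
        = ∫⁻ a in Set.Icc 0 x, ENNReal.ofReal (S a * ν a) := by
      have h2 : Pr {ω | T ω ≤ x ∧ T ω + U ω ≤ η}
          = (Pr.map fun ω => (T ω, U ω)) {p : ℝ × ℝ | p.1 ≤ x ∧ p.1 + p.2 ≤ η} := by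
        rw [Measure.map_apply (hT.prodMk hU) hA]; rfl
      rw [h2, hprod, Measure.prod_apply hA, hpdf,
        lintegral_withDensity_eq_lintegral_mul _ hfm.ennreal_ofReal
          (measurable_measure_prodMk_left hA), ← lintegral_indicator measurableSet_Icc]
      refine lintegral_congr fun a => ?_
      simp only [Pi.mul_apply]
      by_cases ha0 : 0 ≤ a
      · by_cases hax : a ≤ x
        · have e1 : (Prod.mk a ⁻¹' {p : ℝ × ℝ | p.1 ≤ x ∧ p.1 + p.2 ≤ η}) = Set.Iic (η - a) := by
            ext u
            simp only [Set.mem_preimage, Set.mem_setOf_eq, Set.mem_Iic]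
            constructor
            · rintro ⟨_, h⟩; linarith
            · intro h; exact ⟨hax, by linarith⟩
          rw [e1, Set.indicator_of_mem (Set.mem_Icc.2 ⟨ha0, hax⟩),
            Measure.map_apply hU measurableSet_Iic, hf, if_pos ha0]
          have e2 : Pr (U ⁻¹' Set.Iic (η - a)) = ENNReal.ofReal (F (η - a)) := by
            rw [hF, ENNReal.ofReal_toReal (measure_ne_top _ _)]; rfl
          rw [e2, ← ENNReal.ofReal_mul (mul_nonneg (hμnn a) (hSpos a).le), hν]
          congr 1; ring
        · have e1 : (Prod.mk a ⁻¹' {p : ℝ × ℝ | p.1 ≤ x ∧ p.1 + p.2 ≤ η}) = ∅ := by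
            ext u
            simp [hax]
          rw [e1, Set.indicator_of_notMem (fun h => hax h.2)]
          simp
      · rw [Set.indicator_of_notMem (fun h => ha0 h.1), hf, if_neg ha0]
        simp
    rw [hG, h1, intervalIntegral.integral_of_le hx, ← integral_Icc_eq_integral_Ioc,
      integral_eq_lintegral_of_nonneg_ae]
    · exact Filter.Eventually.of_forall fun a => mul_nonneg (hSpos a).le (hνnn a)
    · exact (hSc.mul hνc).aestronglyMeasurable
  have hGt := hGint t ht.1.le
  have hGd : HasDerivAt G (S t * ν t) t := by
    have h1 : HasDerivAt (fun x => ∫ s in (0:ℝ)..x, S s * ν s) (S t * ν t) t :=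
      intervalIntegral.integral_hasDerivAt_right ((hSc.mul hνc).intervalIntegrable _ _)
        (hSc.mul hνc).stronglyMeasurable.stronglyMeasurableAtFilter (hSc.mul hνc).continuousAt
    refine h1.congr_of_eventuallyEq ?_
    filter_upwards [Ioi_mem_nhds ht.1] with x hx
    exact hGint x (le_of_lt hx)
  have hle : ∫ s in (0:ℝ)..t, S s * ν s ≤ ∫ s in (0:ℝ)..t, S s * μ s :=
    intervalIntegral.integral_mono_on ht.1.le ((hSc.mul hνc).intervalIntegrable _ _)
      ((hSc.mul hμc).intervalIntegrable _ _)
      fun x _ => mul_le_mul_of_nonneg_left (hνμ x) (hSpos x).le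
  refine ⟨⟨by rw [hGt]; linarith, hSpos t⟩, ?_⟩
  rw [hGd.deriv, hGt, hSμ]
  ring
end

section
/- Let a < b be real numbers, let μ : ℝ → ℝ be continuous and nonnegative on [a,b], and let p : ℝ → ℝ be measurable with 0 ≤ p(s) ≤ 1 for all s ∈ [a,b]. Define P(s) = exp(−∫_a^s μ(u) du) and the correction factor γ̌ = (1 − ∫_a^b P(s) μ(s) ds) / (1 − ∫_a^b P(s) μ(s) p(s) ds). Then the denominator satisfies 1 − ∫_a^b P(s) μ(s) p(s) ds ≥ P(b) > 0, and exp(−∫_a^b μ(u) du) ≤ γ̌ ≤ 1. -/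
open MeasureTheory

/-- Sandwich bound for the approximate correction factor of the Poisson approximation:
with survival function `P`, hazard `μ`, and reporting probabilities `p` with values in
`[0,1]`, the denominator of `γ̌` is at least `P b > 0`, and
`exp (-∫_a^b μ) ≤ γ̌ ≤ 1`. -/
theorem poisson_correction_sandwich (a b : ℝ) (hab : a < b) (μ p : ℝ → ℝ)
    (hμc : ContinuousOn μ (Set.Icc a b)) (hμnn : ∀ s ∈ Set.Icc a b, 0 ≤ μ s)
    (hpm : Measurable p) (hp : ∀ s ∈ Set.Icc a b, 0 ≤ p s ∧ p s ≤ 1)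
    (P : ℝ → ℝ) (hP : ∀ s, P s = Real.exp (-∫ u in a..s, μ u))
    (γ : ℝ)
    (hγ : γ = (1 - ∫ s in a..b, P s * μ s) / (1 - ∫ s in a..b, P s * μ s * p s)) :
    P b ≤ 1 - ∫ s in a..b, P s * μ s * p s ∧ 0 < P b ∧
      Real.exp (-∫ u in a..b, μ u) ≤ γ ∧ γ ≤ 1 := by
  have hle := hab.le
  have hu : Set.uIcc a b = Set.Icc a b := Set.uIcc_of_le hle
  have hμi : IntervalIntegrable μ volume a b := (hu ▸ hμc).intervalIntegrable
  have hPe : P = fun s => Real.exp (-∫ u in a..s, μ u) := funext hP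
  have hprim : ContinuousOn (fun s => ∫ u in a..s, μ u) (Set.Icc a b) := by
    have := intervalIntegral.continuousOn_primitive_interval' hμi (Set.left_mem_uIcc)
    rwa [hu] at this
  have hPc : ContinuousOn P (Set.Icc a b) := by
    rw [hPe]
    exact Real.continuous_exp.comp_continuousOn hprim.neg
  have hPμc : ContinuousOn (fun s => P s * μ s) (Set.Icc a b) := hPc.mul hμc
  have hPμi : IntervalIntegrable (fun s => P s * μ s) volume a b :=
    ContinuousOn.intervalIntegrable (by rw [hu]; exact hPμc)
  have hder : ∀ x ∈ Set.Ioo a b, HasDerivAt (fun s => -P s) (P x * μ x) x := by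
    intro x hx
    have hnhds : Set.Icc a b ∈ nhds x := Icc_mem_nhds hx.1 hx.2
    have hd : HasDerivAt (fun s => ∫ u in a..s, μ u) (μ x) x := by
      apply intervalIntegral.integral_hasDerivAt_right
      · apply hμi.mono_set
        rw [hu, Set.uIcc_of_le hx.1.le]
        exact Set.Icc_subset_Icc_right hx.2.le
      · exact (hμc.mono Set.Ioo_subset_Icc_self).stronglyMeasurableAtFilter isOpen_Ioo x hx
      · exact hμc.continuousAt hnhds
    have h2 := hd.neg.exp.neg
    rw [hPe]
    exact HasDerivAt.congr_deriv h2 (by simp only [Pi.neg_apply]; ring)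
  have hint : ∫ s in a..b, P s * μ s = 1 - P b := by
    rw [intervalIntegral.integral_eq_sub_of_hasDerivAt_of_le hle hPc.neg hder hPμi]
    have : P a = 1 := by simp [hP]
    rw [Pi.neg_apply, Pi.neg_apply, this]; ring
  have hPpos : ∀ s, 0 < P s := fun s => by rw [hP]; exact Real.exp_pos _
  have hPμnn : ∀ s ∈ Set.Icc a b, 0 ≤ P s * μ s := fun s hs =>
    mul_nonneg (hPpos s).le (hμnn s hs)
  have hi : IntervalIntegrable (fun s => P s * μ s * p s) volume a b := by
    rw [intervalIntegrable_iff_integrableOn_Icc_of_le hle] at hPμi ⊢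
    refine Integrable.mono' hPμi (hPμi.aestronglyMeasurable.mul hpm.aestronglyMeasurable) ?_
    filter_upwards [ae_restrict_mem measurableSet_Icc] with s hs
    have h1 := hPμnn s hs
    have h2 := hp s hs
    rw [Real.norm_eq_abs, abs_of_nonneg (mul_nonneg h1 h2.1)]
    exact mul_le_of_le_one_right h1 h2.2
  have hup : ∫ s in a..b, P s * μ s * p s ≤ ∫ s in a..b, P s * μ s :=
    intervalIntegral.integral_mono_on hle hi hPμi fun s hs =>
      mul_le_of_le_one_right (hPμnn s hs) (hp s hs).2
  have hlo : 0 ≤ ∫ s in a..b, P s * μ s * p s :=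
    intervalIntegral.integral_nonneg hle fun s hs => mul_nonneg (hPμnn s hs) (hp s hs).1
  have hb := hPpos b
  have hD : P b ≤ 1 - ∫ s in a..b, P s * μ s * p s := by linarith
  have hD0 := hb.trans_le hD
  refine ⟨hD, hb, ?_, ?_⟩
  · rw [← hP b, hγ, hint, le_div_iff₀ hD0]
    nlinarith
  · rw [hγ, div_le_one hD0]
    linarith
end

section
/- Let a < b be real numbers, let μ : ℝ → ℝ be continuous and nonnegative on [a,b] with M = sup_{s ∈ [a,b]} μ(s), and let p : ℝ → ℝ be measurable with 0 ≤ p(s) ≤ 1 for all s ∈ [a,b]. Define P(s) = exp(−∫_a^s μ(u) du), the weighted hazard ν(s) = μ(s) p(s), and the correction factor γ̌ = (1 − ∫_a^b P(s) μ(s) ds) / (1 − ∫_a^b P(s) ν(s) ds). Then |γ̌ ν(b) − ν(b)| ≤ (b − a) · M² · exp((b − a) M); in particular the error of the Poisson approximation μ̌ = γ̌·ν to ν is of second order in the hazard over the sojourn interval. -/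
open MeasureTheory

/-- Second-order error bound for the Poisson approximation: with `M` the supremum of the
hazard `μ` over the sojourn interval `[a,b]`, the error of the approximate observed
hazard `γ̌·ν` relative to the weighted hazard `ν` at `b` is at most
`(b - a) · M² · exp ((b - a) · M)`. -/
theorem poisson_error_bound (a b : ℝ) (hab : a < b) (μ p : ℝ → ℝ)
    (hμc : ContinuousOn μ (Set.Icc a b)) (hμnn : ∀ s ∈ Set.Icc a b, 0 ≤ μ s)
    (M : ℝ) (hM : M = sSup (μ '' Set.Icc a b))
    (hpm : Measurable p) (hp : ∀ s ∈ Set.Icc a b, 0 ≤ p s ∧ p s ≤ 1)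
    (P : ℝ → ℝ) (hP : ∀ s, P s = Real.exp (-∫ u in a..s, μ u))
    (ν : ℝ → ℝ) (hν : ∀ s, ν s = μ s * p s)
    (γ : ℝ)
    (hγ : γ = (1 - ∫ s in a..b, P s * μ s) / (1 - ∫ s in a..b, P s * ν s)) :
    |γ * ν b - ν b| ≤ (b - a) * M ^ 2 * Real.exp ((b - a) * M) := by
  have hab' := hab.le
  have hbm : b ∈ Set.Icc a b := ⟨hab', le_rfl⟩
  have hbdd : BddAbove (μ '' Set.Icc a b) := (isCompact_Icc.image_of_continuousOn hμc).bddAbove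
  have hle : ∀ s ∈ Set.Icc a b, μ s ≤ M := fun s hs => by
    rw [hM]; exact le_csSup hbdd ⟨s, hs, rfl⟩
  have hM0 : 0 ≤ M := (hμnn b hbm).trans (hle b hbm)
  have hii : IntervalIntegrable μ volume a b :=
    ContinuousOn.intervalIntegrable (by rwa [Set.uIcc_of_le hab'])
  have hPf : P = fun s => Real.exp (-∫ u in a..s, μ u) := funext hP
  have hcont : ContinuousOn (fun s => ∫ u in a..s, μ u) (Set.Icc a b) := by
    have h := intervalIntegral.continuousOn_primitive_interval' hii
      (Set.left_mem_uIcc : a ∈ Set.uIcc a b)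
    rwa [Set.uIcc_of_le hab'] at h
  have hPc : ContinuousOn P (Set.Icc a b) := by
    rw [hPf]; exact Real.continuous_exp.comp_continuousOn hcont.neg
  have hPpos : ∀ s, 0 < P s := fun s => by rw [hP]; exact Real.exp_pos _
  have hPμ : IntervalIntegrable (fun s => P s * μ s) volume a b :=
    ContinuousOn.intervalIntegrable (by rw [Set.uIcc_of_le hab']; exact hPc.mul hμc)
  have hI1 : ∫ s in a..b, P s * μ s = 1 - P b := by
    have h := intervalIntegral.integral_eq_sub_of_hasDerivAt_of_le (f := fun s => - P s) hab'
      hPc.neg (f' := fun s => P s * μ s) ?_ hPμ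
    · rw [h]
      have : P a = 1 := by rw [hP]; simp
      rw [this]; ring
    · intro x hx
      have hd : HasDerivAt (fun s => ∫ u in a..s, μ u) (μ x) x := by
        apply intervalIntegral.integral_hasDerivAt_right
        · apply hii.mono_set
          rw [Set.uIcc_of_le hab', Set.uIcc_of_le hx.1.le]
          exact Set.Icc_subset_Icc le_rfl hx.2.le
        · exact (hμc.mono Set.Ioo_subset_Icc_self).stronglyMeasurableAtFilter isOpen_Ioo x hx
        · exact hμc.continuousAt (Icc_mem_nhds hx.1 hx.2)
      have h2 := hd.neg.exp.neg
      rw [hPf]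
      convert h2 using 1
      · rfl
      · simp
  have hI2nn : 0 ≤ ∫ s in a..b, P s * ν s := by
    apply intervalIntegral.integral_nonneg hab'
    intro s hs
    rw [hν]
    exact mul_nonneg (hPpos s).le (mul_nonneg (hμnn s hs) (hp s hs).1)
  have hI2le : ∫ s in a..b, P s * ν s ≤ ∫ s in a..b, P s * μ s := by
    rw [intervalIntegral.integral_of_le hab', intervalIntegral.integral_of_le hab']
    apply integral_mono_of_nonneg
    · filter_upwards [ae_restrict_mem measurableSet_Ioc] with s hs
      have hs' := Set.Ioc_subset_Icc_self hs
      simp only [Pi.zero_apply]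
      rw [hν]
      exact mul_nonneg (hPpos s).le (mul_nonneg (hμnn s hs') (hp s hs').1)
    · exact (intervalIntegrable_iff_integrableOn_Ioc_of_le hab').1 hPμ
    · filter_upwards [ae_restrict_mem measurableSet_Ioc] with s hs
      have hs' := Set.Ioc_subset_Icc_self hs
      rw [hν]
      exact mul_le_mul_of_nonneg_left (mul_le_of_le_one_right (hμnn s hs') (hp s hs').2)
        (hPpos s).le
  have hint : ∫ u in a..b, μ u ≤ (b - a) * M := by
    have h := intervalIntegral.integral_mono_on hab' hii
      (intervalIntegrable_const (c := M)) hle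
    simpa using h
  have hPb : 1 - P b ≤ (b - a) * M := by
    have := Real.add_one_le_exp (-∫ u in a..b, μ u)
    rw [← hP] at this
    linarith
  rw [hI1] at hγ hI2le
  have hpos := hPpos b
  generalize (∫ s in a..b, P s * ν s) = J at hγ hI2nn hI2le
  have hJ : 0 < 1 - J := by linarith
  have hγ1 : γ ≤ 1 := by
    rw [hγ, div_le_one hJ]; linarith
  have hγ2 : P b ≤ γ := by
    rw [hγ, le_div_iff₀ hJ]; nlinarith
  have hν0 : 0 ≤ ν b := by
    rw [hν]; exact mul_nonneg (hμnn b hbm) (hp b hbm).1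
  have hνM : ν b ≤ M := by
    rw [hν]; exact (mul_le_of_le_one_right (hμnn b hbm) (hp b hbm).2).trans (hle b hbm)
  have hk : 0 ≤ (b - a) * M := mul_nonneg (by linarith) hM0
  have he : 1 ≤ Real.exp ((b - a) * M) := Real.one_le_exp hk
  calc |γ * ν b - ν b| = (1 - γ) * ν b := by
        rw [abs_of_nonpos (by nlinarith)]; ring
    _ ≤ ((b - a) * M) * M := mul_le_mul (by linarith) hνM hν0 hk
    _ = (b - a) * M ^ 2 := by ring
    _ ≤ (b - a) * M ^ 2 * Real.exp ((b - a) * M) :=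
        le_mul_of_one_le_right (mul_nonneg (by linarith) (sq_nonneg M)) he
end
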